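/- arXiv:2307.09034 — 5 statements merged into one kernel-verified Lean document; each statement's English description precedes it below -/
import Mathlib

section
/- For all real numbers s > 0 and x > 0, one has F(s,x) = 1 - s · e^x · γ̄(s,x); explicitly, -x · ∫_0^1 (1-y)^s e^{xy} dy = 1 - s · e^x · Σ_{k=0}^∞ (-x)^k / ((k+s)·k!). -/
/-- For real `s > 0` and `x > 0`, `F(s,x) = 1 - s · e^x · γ̄(s,x)`, explicitly
`-x · ∫_0^1 (1-y)^s e^{xy} dy = 1 - s · e^x · ∑_{k=0}^∞ (-x)^k / ((k+s)·k!)`. -/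
theorem F_eq_one_sub_gammaBar_real (s x : ℝ) (hs : 0 < s) (hx : 0 < x) :
    -x * ∫ y in (0:ℝ)..1, (1 - y) ^ s * Real.exp (x * y)
      = 1 - s * Real.exp x * ∑' k : ℕ, (-x) ^ k / (((k : ℝ) + s) * (k.factorial : ℝ)) := by
  have hexp : ∀ z : ℝ, HasSum (fun k : ℕ => z ^ k / (k.factorial : ℝ)) (Real.exp z) := by
    intro z
    rw [Real.exp_eq_exp_ℝ]
    exact NormedSpace.expSeries_div_hasSum_exp z
  set I : ℝ := ∫ u in (0:ℝ)..1, u ^ s * Real.exp (-x * u) with hI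
  have h1 : ∫ y in (0:ℝ)..1, (1 - y) ^ s * Real.exp (x * y) = Real.exp x * I := by
    have h := intervalIntegral.integral_comp_sub_left (a := 0) (b := 1)
      (fun u : ℝ => u ^ s * Real.exp (x * (1 - u))) 1
    simp only [sub_sub_cancel, sub_self, sub_zero] at h
    rw [h, hI, ← intervalIntegral.integral_const_mul]
    congr 1
    ext u
    rw [show x * (1 - u) = x + -x * u by ring, Real.exp_add]
    ring
  have hsum : HasSum (fun k : ℕ => ∫ u in (0:ℝ)..1, u ^ s * ((-x * u) ^ k / (k.factorial : ℝ))) I := by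
    apply intervalIntegral.hasSum_integral_of_dominated_convergence
      (fun k _ => x ^ k / (k.factorial : ℝ))
    · intro k
      apply Measurable.aestronglyMeasurable
      fun_prop
    · intro k
      refine Filter.Eventually.of_forall fun u hu => ?_
      rw [Set.uIoc_of_le zero_le_one] at hu
      have hu0 := hu.1
      rw [norm_mul, norm_div, norm_pow, norm_mul, norm_neg, Real.norm_of_nonneg hx.le,
        Real.norm_of_nonneg hu0.le, Real.norm_of_nonneg (Real.rpow_nonneg hu0.le s),
        Real.norm_of_nonneg (by positivity : (0:ℝ) ≤ (k.factorial : ℝ))]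
      have a1 : u ^ s ≤ 1 := Real.rpow_le_one hu0.le hu.2 hs.le
      have a2 : (x * u) ^ k ≤ x ^ k :=
        pow_le_pow_left₀ (by positivity) (by nlinarith [hu.2]) k
      calc u ^ s * ((x * u) ^ k / (k.factorial : ℝ)) ≤ 1 * (x ^ k / (k.factorial : ℝ)) := by
            gcongr
        _ = _ := one_mul _
    · exact Filter.Eventually.of_forall fun u _ => (hexp x).summable
    · simp
    · exact Filter.Eventually.of_forall fun u _ => (hexp (-x * u)).mul_left _
  have hterm : ∀ k : ℕ, ∫ u in (0:ℝ)..1, u ^ s * ((-x * u) ^ k / (k.factorial : ℝ))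
      = (-x) ^ k / (k.factorial : ℝ) * (1 / ((k : ℝ) + s + 1)) := by
    intro k
    have hk : (0:ℝ) ≤ k := Nat.cast_nonneg k
    have : ∫ u in (0:ℝ)..1, u ^ s * ((-x * u) ^ k / (k.factorial : ℝ))
        = ∫ u in (0:ℝ)..1, (-x) ^ k / (k.factorial : ℝ) * u ^ ((k : ℝ) + s) := by
      apply intervalIntegral.integral_congr
      intro u hu
      rw [Set.uIcc_of_le zero_le_one] at hu
      simp only
      rw [Real.rpow_add_of_nonneg hu.1 hk hs.le, Real.rpow_natCast, mul_pow]
      ring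
    rw [this, intervalIntegral.integral_const_mul, integral_rpow (Or.inl (by linarith)),
      Real.one_rpow, Real.zero_rpow (by positivity), sub_zero]
  simp only [hterm] at hsum
  have hb : HasSum (fun k : ℕ => (-x) ^ k / (k.factorial : ℝ) * ((k : ℝ) / ((k : ℝ) + s)))
      (-x * I) := by
    rw [← hasSum_nat_add_iff' 1]
    simp only [Finset.range_one, Finset.sum_singleton, Nat.cast_zero, zero_div, mul_zero, sub_zero]
    have hh := (hsum.mul_left (-x))
    refine (congrArg (fun f => HasSum f _) (funext fun k => ?_)).mpr hh
    have h0 : (k.factorial : ℝ) ≠ 0 := by positivity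
    have h2 : (k : ℝ) + 1 ≠ 0 := by positivity
    have h3 : (k : ℝ) + s + 1 ≠ 0 := by positivity
    have h4 : (k : ℝ) + 1 + s ≠ 0 := by positivity
    rw [Nat.factorial_succ]
    push_cast
    rw [show (k : ℝ) + s + 1 = k + 1 + s by ring]
    field_simp
    try ring
  have ha : HasSum (fun k : ℕ => s * ((-x) ^ k / (((k : ℝ) + s) * (k.factorial : ℝ))))
      (Real.exp (-x) - -x * I) := by
    have hh := ((hexp (-x)).sub hb)
    refine (congrArg (fun f => HasSum f _) (funext fun k => ?_)).mpr hh
    have h0 : (k.factorial : ℝ) ≠ 0 := by positivity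
    have h4 : (k : ℝ) + s ≠ 0 := by positivity
    field_simp
    ring
  have hE : Real.exp x * Real.exp (-x) = 1 := by rw [← Real.exp_add]; simp
  have ht := ha.tsum_eq
  rw [tsum_mul_left] at ht
  rw [h1, mul_comm s, mul_assoc (Real.exp x), ht]
  linear_combination hE
end

section
/- For every s ∈ ℂ with Re(s) > -1 and every x ∈ ℂ, one has F(s,x) = 1 - s · e^x · γ̄(s,x); explicitly, -x · ∫_0^1 (1-y)^s e^{xy} dy = 1 - s · e^x · Σ_{k=0}^∞ (-x)^k / ((k+s)·k!). (For s = 0 the right-hand side is interpreted as 1, the k = 0 term of s·γ̄(s,x) being s/s = 1 in the limit; alternatively the identity is asserted for s ∈ ℂ with Re(s) > -1 and s ≠ 0.) -/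
lemma aux_hasSum (s : ℂ) (hs : -1 < s.re) (x : ℂ) :
    HasSum (fun k : ℕ => (-x) ^ k / (k.factorial : ℂ) * (1 / ((k : ℂ) + s + 1)))
      (∫ t in (0:ℝ)..1, (t : ℂ) ^ s * Complex.exp (-x * (t : ℂ))) := by
  have hint : ∀ k : ℕ, ∫ t in (0:ℝ)..1, (-x) ^ k / (k.factorial : ℂ) * (t : ℂ) ^ (s + k)
      = (-x) ^ k / (k.factorial : ℂ) * (1 / ((k : ℂ) + s + 1)) := by
    intro k
    have hre : -1 < (s + k).re := by
      have : (0:ℝ) ≤ k := Nat.cast_nonneg k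
      simp only [Complex.add_re, Complex.natCast_re]; linarith
    have hne : s + k + 1 ≠ 0 := by
      intro h
      have := congrArg Complex.re h
      rw [Complex.add_re] at this
      simp only [Complex.one_re, Complex.zero_re] at this
      linarith
    rw [intervalIntegral.integral_const_mul, integral_cpow (Or.inl hre)]
    simp only [Complex.ofReal_one, Complex.one_cpow, Complex.ofReal_zero,
      Complex.zero_cpow hne, sub_zero]
    rw [add_comm s]
  have hi : IntervalIntegrable (fun t : ℝ => (t : ℂ) ^ s) MeasureTheory.volume 0 1 :=
    intervalIntegral.intervalIntegrable_cpow' hs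
  have key := intervalIntegral.hasSum_integral_of_dominated_convergence
    (μ := MeasureTheory.volume) (a := 0) (b := 1)
    (F := fun (k : ℕ) (t : ℝ) => (-x) ^ k / (k.factorial : ℂ) * (t : ℂ) ^ (s + k))
    (f := fun t : ℝ => (t : ℂ) ^ s * Complex.exp (-x * (t : ℂ)))
    (fun k t => ‖(t : ℂ) ^ s‖ * (‖x‖ ^ k / k.factorial)) ?_ ?_ ?_ ?_ ?_
  · simpa only [hint] using key
  · intro k
    have : Measurable fun t : ℝ => (-x) ^ k / (k.factorial : ℂ) * (t : ℂ) ^ (s + k) := by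
      fun_prop
    exact this.aestronglyMeasurable
  · intro k
    refine Filter.Eventually.of_forall fun t ht => ?_
    rw [Set.uIoc_of_le zero_le_one] at ht
    have ht0 : (t : ℂ) ≠ 0 := by exact_mod_cast ht.1.ne'
    rw [Complex.cpow_add _ _ ht0, Complex.cpow_natCast, norm_mul, norm_mul, norm_div, norm_pow,
      norm_neg, norm_pow, Complex.norm_natCast, Complex.norm_real, Real.norm_of_nonneg ht.1.le]
    have h1 : t ^ k ≤ 1 := pow_le_one₀ ht.1.le ht.2
    have h2 : 0 ≤ ‖(t : ℂ) ^ s‖ * (‖x‖ ^ k / k.factorial) := by positivity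
    nlinarith
  · refine Filter.Eventually.of_forall fun t _ => ?_
    exact (Real.summable_pow_div_factorial ‖x‖).mul_left _
  · simp only [tsum_mul_left]
    exact hi.norm.mul_const _
  · refine Filter.Eventually.of_forall fun t ht => ?_
    rw [Set.uIoc_of_le zero_le_one] at ht
    have ht0 : (t : ℂ) ≠ 0 := by exact_mod_cast ht.1.ne'
    have h := (NormedSpace.expSeries_div_hasSum_exp (-x * (t : ℂ))).mul_left ((t : ℂ) ^ s)
    rw [← Complex.exp_eq_exp_ℂ] at h
    refine h.congr_fun ?_
    intro k
    rw [Complex.cpow_add _ _ ht0, Complex.cpow_natCast, mul_pow]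
    ring

/-- For every `s ∈ ℂ` with `Re(s) > -1` and `s ≠ 0`, and every `x ∈ ℂ`,
`F(s,x) = 1 - s · e^x · γ̄(s,x)`, explicitly
`-x · ∫_0^1 (1-y)^s e^{xy} dy = 1 - s · e^x · ∑_{k=0}^∞ (-x)^k / ((k+s)·k!)`. -/
theorem F_eq_one_sub_gammaBar (s : ℂ) (hs : -1 < s.re) (hs0 : s ≠ 0) (x : ℂ) :
    -x * ∫ y in (0:ℝ)..1,
        Complex.exp (s * (Real.log (1 - y) : ℂ)) * Complex.exp (x * (y : ℂ))
      = 1 - s * Complex.exp x *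
          ∑' k : ℕ, (-x) ^ k / (((k : ℂ) + s) * (k.factorial : ℂ)) := by
  have hne : ∀ k : ℕ, (k : ℂ) + s ≠ 0 := by
    intro k h
    rcases Nat.eq_zero_or_pos k with rfl | hk
    · simp at h; exact hs0 h
    · have h1 : (1:ℝ) ≤ k := by exact_mod_cast hk
      have := congrArg Complex.re h
      simp only [Complex.add_re, Complex.natCast_re, Complex.zero_re] at this
      linarith
  have hI : ∫ y in (0:ℝ)..1,
        Complex.exp (s * (Real.log (1 - y) : ℂ)) * Complex.exp (x * (y : ℂ))
      = Complex.exp x * ∫ t in (0:ℝ)..1, (t : ℂ) ^ s * Complex.exp (-x * (t : ℂ)) := by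
    have h := intervalIntegral.integral_comp_sub_left (a := 0) (b := 1)
      (fun t : ℝ => Complex.exp (s * (Real.log t : ℂ)) * Complex.exp (x * ((1 - t : ℝ) : ℂ))) 1
    simp only [sub_sub_cancel, sub_self, sub_zero] at h
    rw [h, ← intervalIntegral.integral_const_mul]
    refine intervalIntegral.integral_congr_ae (Filter.Eventually.of_forall fun t ht => ?_)
    rw [Set.uIoc_of_le zero_le_one] at ht
    have ht0 : (t : ℂ) ≠ 0 := by exact_mod_cast ht.1.ne'
    rw [Complex.cpow_def_of_ne_zero ht0, ← Complex.ofReal_log ht.1.le, ← Complex.exp_add,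
      ← Complex.exp_add, ← Complex.exp_add]
    congr 1
    push_cast
    ring
  have hS := (aux_hasSum s hs x).mul_left (-x)
  -- shifted series
  have hS' : HasSum (fun k : ℕ => (-x) ^ k / (k.factorial : ℂ) * (k / ((k : ℂ) + s)))
      (-x * ∫ t in (0:ℝ)..1, (t : ℂ) ^ s * Complex.exp (-x * (t : ℂ))) := by
    rw [← hasSum_nat_add_iff' 1]
    simp only [Finset.range_one, Finset.sum_singleton, Nat.cast_zero, zero_div, mul_zero, sub_zero]
    refine hS.congr_fun ?_
    intro k
    have h1 := hne (k + 1)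
    have h2 : (k.factorial : ℂ) ≠ 0 := by exact_mod_cast k.factorial_ne_zero
    have h3 : (k : ℂ) + 1 ≠ 0 := by exact_mod_cast k.succ_ne_zero
    have h4 : (k : ℂ) + s + 1 ≠ 0 := by
      push_cast at h1; intro h; apply h1; rw [← h]; ring
    rw [Nat.factorial_succ]
    push_cast at h1 ⊢
    rw [show (k : ℂ) + 1 + s = k + s + 1 by ring]
    field_simp
    try ring
  have hE := NormedSpace.expSeries_div_hasSum_exp (-x)
  rw [← Complex.exp_eq_exp_ℂ] at hE
  have hD := (hE.sub hS').mul_left (1 / s)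
  have hG : (fun k : ℕ => (-x) ^ k / (((k : ℂ) + s) * (k.factorial : ℂ))) =
      fun k : ℕ => 1 / s * ((-x) ^ k / (k.factorial : ℂ)
        - (-x) ^ k / (k.factorial : ℂ) * (k / ((k : ℂ) + s))) := by
    funext k
    have h1 := hne k
    have h2 : (k.factorial : ℂ) ≠ 0 := by exact_mod_cast k.factorial_ne_zero
    field_simp
    ring
  rw [hG, hD.tsum_eq, hI]
  have he : Complex.exp x * Complex.exp (-x) = 1 := by
    rw [← Complex.exp_add]; simp
  field_simp
  linear_combination he
end

section
/- Let a > 0 and q > 0 be real numbers, and let G(θ) = (a/q) · ∫_0^1 (1-x)^{-θ/q} e^{-ax/q} dx for θ ∈ [0,q). Then G(θ) tends to +∞ as θ tends to q from the left. -/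
/-- For real `a > 0` and `q > 0`, the function
`G(θ) = (a/q) · ∫_0^1 (1-x)^{-θ/q} e^{-ax/q} dx` tends to `+∞` as `θ → q⁻`. -/
theorem G_tendsto_atTop (a q : ℝ) (ha : 0 < a) (hq : 0 < q) :
    Filter.Tendsto
      (fun θ : ℝ => (a / q) * ∫ x in (0:ℝ)..1, (1 - x) ^ (-θ / q) * Real.exp (-(a * x) / q))
      (nhdsWithin q (Set.Iio q)) Filter.atTop := by
  have hlim : Filter.Tendsto (fun θ : ℝ => (a / q) * ((-θ / q + 1)⁻¹ * Real.exp (-a / q)))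
      (nhdsWithin q (Set.Iio q)) Filter.atTop := by
    refine Filter.Tendsto.const_mul_atTop (by positivity) ?_
    refine Filter.Tendsto.atTop_mul_const (Real.exp_pos _) ?_
    refine Filter.Tendsto.inv_tendsto_nhdsGT_zero ?_
    refine tendsto_nhdsWithin_iff.2 ⟨?_, ?_⟩
    · have hc : Continuous (fun θ : ℝ => -θ / q + 1) := by fun_prop
      have h := hc.tendsto q
      have h0 : -q / q + 1 = 0 := by field_simp; ring
      rw [h0] at h
      exact h.mono_left nhdsWithin_le_nhds
    · filter_upwards [self_mem_nhdsWithin] with θ hθ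
      have : θ / q < 1 := (div_lt_one hq).2 hθ
      simp only [Set.mem_Ioi, neg_div]
      linarith
  refine Filter.tendsto_atTop_mono' _ ?_ hlim
  filter_upwards [self_mem_nhdsWithin] with θ hθ
  have hr : -1 < -θ / q := by
    have : θ / q < 1 := (div_lt_one hq).2 hθ
    rw [neg_div]; linarith
  have hint : IntervalIntegrable (fun x : ℝ => (1 - x) ^ (-θ / q)) MeasureTheory.volume 0 1 := by
    have h := (intervalIntegral.intervalIntegrable_rpow' (a := 0) (b := 1) hr).comp_sub_left 1
    simpa using h.symm
  have hval : ∫ x in (0:ℝ)..1, (1 - x) ^ (-θ / q) = (-θ / q + 1)⁻¹ := by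
    rw [intervalIntegral.integral_comp_sub_left (fun x : ℝ => x ^ (-θ / q)) 1,
      integral_rpow (Or.inl hr)]
    have h0 : -θ / q + 1 ≠ 0 := by linarith
    simp [Real.zero_rpow h0]
  refine mul_le_mul_of_nonneg_left ?_ (by positivity)
  rw [← hval, ← intervalIntegral.integral_mul_const]
  refine intervalIntegral.integral_mono_on zero_le_one (hint.mul_const _)
    (hint.mul_continuousOn (by fun_prop)) ?_
  intro x hx
  refine mul_le_mul_of_nonneg_left ?_ (Real.rpow_nonneg (by linarith [hx.2]) _)
  refine Real.exp_le_exp.2 ?_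
  have : a * x ≤ a := by nlinarith [hx.2]
  gcongr
end

section
/- Let a > 0 and q > 0 be real numbers. There exists a unique θ̃ ∈ (0,q) such that (a/q) · ∫_0^1 (1-x)^{-θ̃/q} e^{-ax/q} dx = 1. -/
open MeasureTheory Set in
theorem tt_int (c s : ℝ) (hs : s < 1) :
    IntervalIntegrable (fun x : ℝ => (1 - x) ^ (-s) * Real.exp (-(c * x))) volume 0 1 := by
  have h : IntervalIntegrable (fun x : ℝ => x ^ (-s)) volume 0 1 :=
    intervalIntegral.intervalIntegrable_rpow' (by linarith)
  have h2 := (h.comp_sub_left 1).symm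
  simp only [sub_self, sub_zero] at h2
  exact h2.mul_continuousOn (by fun_prop)

theorem tt_int0 (s : ℝ) (hs : s < 1) :
    IntervalIntegrable (fun x : ℝ => (1 - x) ^ (-s)) MeasureTheory.volume 0 1 := by
  simpa using tt_int 0 s hs

theorem tt_val (s : ℝ) (hs : s < 1) :
    ∫ x in (0:ℝ)..1, (1 - x) ^ (-s) = 1 / (1 - s) := by
  rw [intervalIntegral.integral_comp_sub_left (fun x : ℝ => x ^ (-s)) 1,
    integral_rpow (Or.inl (by linarith))]
  have : -s + 1 ≠ 0 := by linarith
  simp [Real.zero_rpow this]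
  ring

theorem tt_mono (c s t : ℝ) (hst : s < t) (ht : t < 1) :
    ∫ x in (0:ℝ)..1, (1 - x) ^ (-s) * Real.exp (-(c * x)) <
    ∫ x in (0:ℝ)..1, (1 - x) ^ (-t) * Real.exp (-(c * x)) := by
  rw [← sub_pos, ← intervalIntegral.integral_sub (tt_int c t ht) (tt_int c s (hst.trans ht))]
  refine intervalIntegral.intervalIntegral_pos_of_pos_on
    ((tt_int c t ht).sub (tt_int c s (hst.trans ht))) ?_ one_pos
  rintro x ⟨h0, h1⟩
  have : (1 - x) ^ (-s) < (1 - x) ^ (-t) :=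
    Real.rpow_lt_rpow_of_exponent_gt (by linarith) (by linarith) (by linarith)
  have h2 := mul_lt_mul_of_pos_right this (Real.exp_pos (-(c * x)))
  simpa using h2

open MeasureTheory Set in
theorem tt_cont (c S : ℝ) (hc : 0 < c) (hS : S < 1) :
    ContinuousOn (fun s : ℝ => ∫ x in (0:ℝ)..1, (1 - x) ^ (-s) * Real.exp (-(c * x)))
      (Icc 0 S) := by
  simp only [intervalIntegral.integral_of_le zero_le_one, integral_Ioc_eq_integral_Ioo]
  refine continuousOn_of_dominated (bound := fun x : ℝ => (1 - x) ^ (-S)) ?_ ?_ ?_ ?_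
  · intro s hs
    exact (((tt_int c s (hs.2.trans_lt hS)).1).mono_set Ioo_subset_Ioc_self).aestronglyMeasurable
  · intro s hs
    filter_upwards [ae_restrict_mem measurableSet_Ioo] with x hx
    have hx1 : 0 < 1 - x := by linarith [hx.2]
    have h1 : (1 - x) ^ (-s) ≤ (1 - x) ^ (-S) :=
      Real.rpow_le_rpow_of_exponent_ge hx1 (by linarith [hx.1]) (by linarith [hs.2])
    have h2 : Real.exp (-(c * x)) ≤ 1 := by
      rw [Real.exp_le_one_iff]; nlinarith [hx.1]
    have h3 := Real.rpow_pos_of_pos hx1 (-s)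
    rw [Real.norm_of_nonneg (by positivity)]
    nlinarith
  · exact ((tt_int0 S hS).1).mono_set Ioo_subset_Ioc_self
  · filter_upwards [ae_restrict_mem measurableSet_Ioo] with x hx
    have hx1 : 1 - x ≠ 0 := by linarith [hx.2]
    have h : Continuous fun s : ℝ => (1 - x) ^ (-s) :=
      continuous_iff_continuousAt.2 fun s =>
        (Real.continuousAt_const_rpow hx1).comp (f := fun s : ℝ => -s) continuous_neg.continuousAt
    exact (h.mul continuous_const).continuousOn

theorem tt_zero (c : ℝ) (hc : 0 < c) :
    c * ∫ x in (0:ℝ)..1, (1 - x) ^ (-(0:ℝ)) * Real.exp (-(c * x)) < 1 := by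
  have h : ∫ x in (0:ℝ)..1, Real.exp (-(c * x)) = (1 - Real.exp (-c)) / c := by
    have := intervalIntegral.integral_comp_mul_left (a := 0) (b := 1) Real.exp
      (c := -c) (by linarith)
    simp only [neg_mul] at this
    rw [this, integral_exp]
    simp
    field_simp
    ring
  simp only [neg_zero, Real.rpow_zero, one_mul, h]
  rw [mul_div_cancel₀ _ hc.ne']
  linarith [Real.exp_pos (-c)]

theorem tt_big (c s : ℝ) (hc : 0 < c) (hs : s < 1) :
    Real.exp (-c) / (1 - s) ≤ ∫ x in (0:ℝ)..1, (1 - x) ^ (-s) * Real.exp (-(c * x)) := by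
  have h : ∫ x in (0:ℝ)..1, (1 - x) ^ (-s) * Real.exp (-c) = Real.exp (-c) / (1 - s) := by
    rw [intervalIntegral.integral_mul_const, tt_val s hs]; ring
  rw [← h]
  refine intervalIntegral.integral_mono_on zero_le_one ((tt_int0 s hs).mul_const _)
    (tt_int c s hs) ?_
  intro x hx
  have h1 : 0 ≤ (1 - x) ^ (-s) := Real.rpow_nonneg (by linarith [hx.2]) _
  have h2 : Real.exp (-c) ≤ Real.exp (-(c * x)) := by
    rw [Real.exp_le_exp]; nlinarith [hx.2]
  exact mul_le_mul_of_nonneg_left h2 h1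

theorem tt_exists (c : ℝ) (hc : 0 < c) :
    ∃ s ∈ Set.Ioo (0:ℝ) 1,
      c * ∫ x in (0:ℝ)..1, (1 - x) ^ (-s) * Real.exp (-(c * x)) = 1 := by
  have he := Real.exp_pos (-c)
  have hp : 0 < c * Real.exp (-c) := by positivity
  have hlt : c * Real.exp (-c) < 1 := by
    have h1 := Real.add_one_le_exp c
    have h2 : Real.exp c * Real.exp (-c) = 1 := by rw [← Real.exp_add]; simp
    nlinarith
  have hS : 1 - c * Real.exp (-c) < 1 := by linarith
  have hbig := tt_big c _ hc hS
  have hge : 1 ≤ c * ∫ x in (0:ℝ)..1, (1 - x) ^ (-(1 - c * Real.exp (-c))) *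
      Real.exp (-(c * x)) := by
    refine le_trans (le_of_eq ?_) (mul_le_mul_of_nonneg_left hbig hc.le)
    rw [sub_sub_cancel]
    field_simp
  have hcont := (continuousOn_const (c := c)).mul (tt_cont c _ hc hS)
  obtain ⟨s, hs, h⟩ := intermediate_value_Icc (by linarith) hcont ⟨(tt_zero c hc).le, hge⟩
  refine ⟨s, ⟨lt_of_le_of_ne hs.1 ?_, hs.2.trans_lt hS⟩, h⟩
  rintro rfl
  exact (tt_zero c hc).ne h

/-- For real `a > 0` and `q > 0`, there exists a unique `θ̃ ∈ (0,q)` such that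
`(a/q) · ∫_0^1 (1-x)^{-θ̃/q} e^{-ax/q} dx = 1`. -/
theorem exists_unique_theta_tilde (a q : ℝ) (ha : 0 < a) (hq : 0 < q) :
    ∃! θ : ℝ, θ ∈ Set.Ioo 0 q ∧
      (a / q) * ∫ x in (0:ℝ)..1, (1 - x) ^ (-θ / q) * Real.exp (-(a * x) / q) = 1 := by
  have hc : 0 < a / q := by positivity
  have e1 : ∀ x : ℝ, -(a * x) / q = -(a / q * x) := fun x => by ring
  simp only [e1, neg_div]
  obtain ⟨s, ⟨hs0, hs1⟩, h⟩ := tt_exists (a / q) hc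
  have hsq : s * q / q = s := by field_simp
  refine ⟨s * q, ⟨⟨by positivity, by nlinarith⟩, by simpa only [hsq] using h⟩, ?_⟩
  rintro t ⟨⟨ht0, ht1⟩, ht⟩
  have ht1' : t / q < 1 := (div_lt_one hq).2 ht1
  have key : t / q = s := by
    have heq := mul_left_cancel₀ hc.ne' (ht.trans h.symm)
    rcases lt_trichotomy (t / q) s with hl | hl | hl
    · exact absurd heq (tt_mono (a / q) _ _ hl hs1).ne
    · exact hl
    · exact absurd heq (tt_mono (a / q) _ _ hl ht1').ne'
  rw [← key]; field_simp
end

section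
/- Let a > 0 and q > 0 be real numbers. Suppose θ* ∈ (0,q) is the unique solution in (0,q) of Σ_{k=0}^∞ (a/q)^k / ((k - θ/q)·k!) = 0 (i.e. γ̄(-θ/q, -a/q) = 0 has θ* as its unique solution in (0,q)). Then θ* is also the unique solution in (0,q) of the equation 1 = (a/q) · ∫_0^1 (1-x)^{-θ/q} e^{-ax/q} dx. -/
lemma aux_integral (c s : ℝ) (hc : 0 < c) (hs0 : 0 < s) (hs1 : s < 1) :
    HasSum (fun k : ℕ => c ^ k / (k.factorial : ℝ) * (1 / ((k : ℝ) + 1 - s)))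
      (∫ u in (0:ℝ)..1, u ^ (-s) * Real.exp (c * u)) := by
  have hint : ∀ k : ℕ, ∫ u in (0:ℝ)..1, c ^ k / (k.factorial : ℝ) * u ^ ((k : ℝ) - s)
      = c ^ k / (k.factorial : ℝ) * (1 / ((k : ℝ) + 1 - s)) := by
    intro k
    have hk : (0:ℝ) ≤ k := Nat.cast_nonneg k
    rw [intervalIntegral.integral_const_mul, integral_rpow (Or.inl (by linarith)),
      Real.one_rpow, Real.zero_rpow (by linarith)]
    congr 2 <;> ring
  simp_rw [← hint]
  refine intervalIntegral.hasSum_integral_of_dominated_convergence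
    (fun k u => c ^ k / (k.factorial : ℝ) * u ^ (-s)) ?_ ?_ ?_ ?_ ?_
  · intro k
    apply Measurable.aestronglyMeasurable
    fun_prop
  · intro k
    refine Filter.Eventually.of_forall fun u hu => ?_
    rw [Set.uIoc_of_le zero_le_one] at hu
    have hu0 : 0 < u := hu.1
    rw [Real.norm_of_nonneg (by positivity)]
    have h : u ^ ((k:ℝ) - s) ≤ u ^ (-s) :=
      Real.rpow_le_rpow_of_exponent_ge hu0 hu.2 (by linarith [(Nat.cast_nonneg k : (0:ℝ) ≤ k)])
    gcongr
  · refine Filter.Eventually.of_forall fun u _ => ?_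
    exact (Real.summable_pow_div_factorial c).mul_right _
  · simp_rw [tsum_mul_right]
    exact (intervalIntegral.intervalIntegrable_rpow' (by linarith)).const_mul _
  · refine Filter.Eventually.of_forall fun u hu => ?_
    rw [Set.uIoc_of_le zero_le_one] at hu
    have hu0 : 0 < u := hu.1
    have h := (NormedSpace.expSeries_div_hasSum_exp (c * u)).mul_left (u ^ (-s))
    rw [← Real.exp_eq_exp_ℝ] at h
    refine h.congr_fun ?_
    intro k
    rw [sub_eq_add_neg, Real.rpow_add hu0, Real.rpow_natCast, mul_pow]
    ring

lemma aux_subst (c s : ℝ) :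
    ∫ x in (0:ℝ)..1, (1 - x) ^ (-s) * Real.exp (-(c * x))
      = Real.exp (-c) * ∫ u in (0:ℝ)..1, u ^ (-s) * Real.exp (c * u) := by
  have h := intervalIntegral.integral_comp_sub_left (a := 0) (b := 1)
    (fun u : ℝ => Real.exp (-c) * (u ^ (-s) * Real.exp (c * u))) 1
  rw [← intervalIntegral.integral_const_mul]
  rw [sub_self, sub_zero] at h
  rw [← h]
  congr 1
  ext x
  have : Real.exp (-(c * x)) = Real.exp (-c) * Real.exp (c * (1 - x)) := by
    rw [← Real.exp_add]; congr 1; ring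
  rw [this]; ring

lemma aux_key (c s : ℝ) (hc : 0 < c) (hs0 : 0 < s) (hs1 : s < 1) :
    c * ∫ x in (0:ℝ)..1, (1 - x) ^ (-s) * Real.exp (-(c * x))
      = 1 + s * Real.exp (-c) *
        ∑' k : ℕ, c ^ k / (((k : ℝ) - s) * (k.factorial : ℝ)) := by
  rw [aux_subst]
  set J := ∫ u in (0:ℝ)..1, u ^ (-s) * Real.exp (c * u) with hJ
  have hI : HasSum _ J := aux_integral c s hc hs0 hs1
  have hE := NormedSpace.expSeries_div_hasSum_exp c
  rw [← Real.exp_eq_exp_ℝ] at hE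
  have hE1 := (hasSum_nat_add_iff' 1).mpr hE
  have hD := ((hI.mul_left c).sub hE1).div_const s
  have hD' : HasSum (fun k : ℕ => c ^ (k+1) / ((((k+1 : ℕ) : ℝ) - s) * ((k+1).factorial : ℝ)))
      ((c * J - (Real.exp c - ∑ i ∈ Finset.range 1, c ^ i / (i.factorial : ℝ))) / s) := by
    refine hD.congr_fun ?_
    intro k
    have hk : (0:ℝ) ≤ k := Nat.cast_nonneg k
    have h1 : (k:ℝ) + 1 - s ≠ 0 := by linarith
    have h2 : (k:ℝ) + 1 ≠ 0 := by linarith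
    have h3 : (k.factorial : ℝ) ≠ 0 := by positivity
    rw [Nat.factorial_succ]
    push_cast
    field_simp
    ring
  have hS := ((hasSum_nat_add_iff (f := fun k : ℕ =>
    c ^ k / (((k : ℝ) - s) * (k.factorial : ℝ))) 1).mp hD').tsum_eq
  rw [hS]
  have he : Real.exp (-c) * Real.exp c = 1 := by rw [← Real.exp_add]; simp
  simp only [Finset.sum_range_one, pow_zero, Nat.factorial_zero, Nat.cast_zero, Nat.cast_one,
    zero_sub, mul_one, div_one]
  have : s * Real.exp (-c) * ((c * J - (Real.exp c - 1)) / s + 1 / (-s))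
      = Real.exp (-c) * c * J - Real.exp (-c) * Real.exp c := by
    field_simp
    ring
  rw [this, he]
  ring

/-- Let `a > 0`, `q > 0` and suppose `θ* ∈ (0,q)` is the unique solution in `(0,q)`
of `∑_{k=0}^∞ (a/q)^k / ((k - θ/q)·k!) = 0`. Then `θ*` is also the unique solution
in `(0,q)` of `1 = (a/q) · ∫_0^1 (1-x)^{-θ/q} e^{-ax/q} dx`. -/
theorem main_theorem (a q θstar : ℝ) (ha : 0 < a) (hq : 0 < q)
    (hθ : θstar ∈ Set.Ioo 0 q)
    (hroot : ∑' k : ℕ, (a / q) ^ k / (((k : ℝ) - θstar / q) * (k.factorial : ℝ)) = 0)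
    (huniq : ∀ θ ∈ Set.Ioo (0:ℝ) q,
      ∑' k : ℕ, (a / q) ^ k / (((k : ℝ) - θ / q) * (k.factorial : ℝ)) = 0 → θ = θstar) :
    ((a / q) * ∫ x in (0:ℝ)..1, (1 - x) ^ (-θstar / q) * Real.exp (-(a * x) / q) = 1) ∧
      ∀ θ ∈ Set.Ioo (0:ℝ) q,
        (a / q) * ∫ x in (0:ℝ)..1, (1 - x) ^ (-θ / q) * Real.exp (-(a * x) / q) = 1 →
          θ = θstar := by
  have hiff : ∀ θ ∈ Set.Ioo (0:ℝ) q,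
      ((a / q) * ∫ x in (0:ℝ)..1, (1 - x) ^ (-θ / q) * Real.exp (-(a * x) / q) = 1) ↔
      ∑' k : ℕ, (a / q) ^ k / (((k : ℝ) - θ / q) * (k.factorial : ℝ)) = 0 := by
    intro θ h
    have hs0 : 0 < θ / q := div_pos h.1 hq
    have hs1 : θ / q < 1 := (div_lt_one hq).mpr h.2
    have key := aux_key (a / q) (θ / q) (div_pos ha hq) hs0 hs1
    have e : ∀ x : ℝ, -(a * x) / q = -(a / q * x) := fun x => by ring
    simp_rw [e, neg_div]
    rw [key]
    have : θ / q * Real.exp (-(a / q)) ≠ 0 := (mul_pos hs0 (Real.exp_pos _)).ne'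
    simp [hs0.ne']
  exact ⟨(hiff θstar hθ).mpr hroot, fun θ h hI => huniq θ h ((hiff θ h).mp hI)⟩
end
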